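/- arXiv:2501.13701 — 6 statements merged into one kernel-verified Lean document; each statement's English description precedes it below -/
import Mathlib

section
/- Let G be a connected simple graph on a finite vertex type V and H a connected simple graph on a finite vertex type W. Suppose O : Fin ℓ → Finset V is an orbit enumeration of G, Q : Fin ℓ → Finset W is an orbit enumeration of H, and there is a single matrix S : Matrix (Fin ℓ) (Fin ℓ) ℕ that is an orbit divisor matrix of G relative to O and of H relative to Q. Then for every i ∈ Fin ℓ, (O i).card * Fintype.card W = (Q i).card * Fintype.card V; that is, corresponding orbits of orbitally similar connected graphs have the same relative size, so the graphs have the same orbit distribution vector. -/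
open Classical Finset

/-- `O : Fin ℓ → Finset V` is an orbit enumeration of the graph `G`:
every vertex lies in exactly one `O i`, and each `O i` is an orbit of the
automorphism group of `G` acting on the vertices. -/
def IsOrbitEnum {V : Type*} (G : SimpleGraph V) {ℓ : ℕ} (O : Fin ℓ → Finset V) : Prop :=
  (∀ v : V, ∃! i, v ∈ O i) ∧
  ∀ i : Fin ℓ, ∃ w : V, ∀ v : V, v ∈ O i ↔ ∃ φ : G ≃g G, φ w = v

/-- `S` is the orbit divisor matrix of `G` relative to the orbit enumeration `O`:
for every vertex `u ∈ O i`, the number of vertices of `O j` adjacent to `u` is `S i j`. -/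
def IsOrbitDivisorMatrix {V : Type*} (G : SimpleGraph V) {ℓ : ℕ}
    (O : Fin ℓ → Finset V) (S : Matrix (Fin ℓ) (Fin ℓ) ℕ) : Prop :=
  ∀ i j : Fin ℓ, ∀ u ∈ O i, ((O j).filter fun v => G.Adj u v).card = S i j

/-- Two graphs are orbitally similar if they admit orbit enumerations with a
common orbit divisor matrix. -/
def OrbitallySimilar {V W : Type*} (G : SimpleGraph V) (H : SimpleGraph W) : Prop :=
  ∃ (ℓ : ℕ) (O : Fin ℓ → Finset V) (Q : Fin ℓ → Finset W) (S : Matrix (Fin ℓ) (Fin ℓ) ℕ),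
    IsOrbitEnum G O ∧ IsOrbitEnum H Q ∧
    IsOrbitDivisorMatrix G O S ∧ IsOrbitDivisorMatrix H Q S

/-- The entries of an orbit divisor matrix satisfy the balance equation obtained by counting
the edges between two orbits from both sides. -/
theorem IsOrbitDivisorMatrix.card_mul_eq {V : Type*} {G : SimpleGraph V} {ℓ : ℕ}
    {O : Fin ℓ → Finset V} {S : Matrix (Fin ℓ) (Fin ℓ) ℕ} (hS : IsOrbitDivisorMatrix G O S)
    (i j : Fin ℓ) : (O i).card * S i j = (O j).card * S j i := by
  refine Finset.card_mul_eq_card_mul G.Adj (fun u hu => ?_) (fun v hv => ?_)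
  · exact hS i j u hu
  · simpa only [Finset.bipartiteBelow, G.adj_comm v] using hS j i v hv

theorem IsOrbitDivisorMatrix.entry_pos {V : Type*} {G : SimpleGraph V} {ℓ : ℕ}
    {O : Fin ℓ → Finset V} {S : Matrix (Fin ℓ) (Fin ℓ) ℕ} (hS : IsOrbitDivisorMatrix G O S)
    {i j : Fin ℓ} {u v : V} (hu : u ∈ O i) (hv : v ∈ O j) (huv : G.Adj u v) : 0 < S i j := by
  rw [← hS i j u hu]
  exact Finset.card_pos.2 ⟨v, Finset.mem_filter.2 ⟨hv, huv⟩⟩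

theorem IsOrbitEnum.nonempty {V : Type*} {G : SimpleGraph V} {ℓ : ℕ} {O : Fin ℓ → Finset V}
    (hO : IsOrbitEnum G O) (i : Fin ℓ) : (O i).Nonempty := by
  obtain ⟨w, hw⟩ := hO.2 i
  exact ⟨w, (hw w).2 ⟨SimpleGraph.Iso.refl, rfl⟩⟩

theorem IsOrbitEnum.sum_card {V : Type*} [Fintype V] {G : SimpleGraph V} {ℓ : ℕ}
    {O : Fin ℓ → Finset V} (hO : IsOrbitEnum G O) : ∑ i, (O i).card = Fintype.card V := by
  rw [← Finset.card_biUnion fun i _ j _ hij =>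
    Finset.disjoint_left.2 fun v hi hj => hij ((hO.1 v).unique hi hj), ← Finset.card_univ]
  congr 1
  ext v
  simpa using (hO.1 v).exists

/-- Along a path in `G`, the sizes of corresponding orbits of `G` and `H` stay proportional. -/
theorem card_mul_card_eq_of_reachable {V W : Type*} {G : SimpleGraph V} {H : SimpleGraph W}
    {ℓ : ℕ} {O : Fin ℓ → Finset V} {Q : Fin ℓ → Finset W} {S : Matrix (Fin ℓ) (Fin ℓ) ℕ}
    (hO : IsOrbitEnum G O) (hSG : IsOrbitDivisorMatrix G O S) (hSH : IsOrbitDivisorMatrix H Q S)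
    {u v : V} (huv : G.Reachable u v) {i j : Fin ℓ} (hu : u ∈ O i) (hv : v ∈ O j) :
    (O i).card * (Q j).card = (O j).card * (Q i).card := by
  obtain ⟨p⟩ := huv
  induction p generalizing i with
  | nil => rw [(hO.1 _).unique hu hv]
  | @cons u w v huw p ih =>
    obtain ⟨k, hk⟩ := (hO.1 w).exists
    have hkj := ih hk hv
    have hG := hSG.card_mul_eq i k
    have hH := hSH.card_mul_eq i k
    have hOk : 0 < (O k).card := Finset.card_pos.2 (hO.nonempty k)
    have hik : (O i).card * (Q k).card = (O k).card * (Q i).card := by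
      have hpos' := hSG.entry_pos hk hu huw.symm
      refine Nat.eq_of_mul_eq_mul_right hpos' ?_
      calc (O i).card * (Q k).card * S k i = (O i).card * ((Q k).card * S k i) := by ring
        _ = (O i).card * S i k * (Q i).card := by rw [← hH]; ring
        _ = (O k).card * (Q i).card * S k i := by rw [hG]; ring
    refine Nat.eq_of_mul_eq_mul_right hOk ?_
    calc (O i).card * (Q j).card * (O k).card = (O i).card * ((O k).card * (Q j).card) := by ring
      _ = (O j).card * ((O i).card * (Q k).card) := by rw [hkj]; ring
      _ = (O j).card * (Q i).card * (O k).card := by rw [hik]; ring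

/-- Corresponding orbits of orbitally similar connected graphs have the same
relative size: orbitally similar graphs have the same orbit distribution vector. -/
theorem orbit_relative_size_eq {V W : Type*} [Fintype V] [Fintype W]
    (G : SimpleGraph V) (H : SimpleGraph W) (hG : G.Connected) (hH : H.Connected)
    {ℓ : ℕ} (O : Fin ℓ → Finset V) (Q : Fin ℓ → Finset W) (S : Matrix (Fin ℓ) (Fin ℓ) ℕ)
    (hO : IsOrbitEnum G O) (hQ : IsOrbitEnum H Q)
    (hSG : IsOrbitDivisorMatrix G O S) (hSH : IsOrbitDivisorMatrix H Q S) (i : Fin ℓ) :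
    (O i).card * Fintype.card W = (Q i).card * Fintype.card V := by
  obtain ⟨u, hu⟩ := hO.nonempty i
  rw [← hO.sum_card, ← hQ.sum_card, Finset.mul_sum, Finset.mul_sum]
  refine Finset.sum_congr rfl fun j _ => ?_
  obtain ⟨v, hv⟩ := hO.nonempty j
  rw [card_mul_card_eq_of_reachable hO hSG hSH (hG u v) hu hv, mul_comm]
end

section
/- Let G and H be orbitally similar connected simple graphs on finite vertex types V and W respectively. Then the prisms G □ K₂ and H □ K₂ (the box products of G, respectively H, with the complete graph on two vertices) are orbitally similar connected graphs. -/
open Classical Finset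

/-- The box product of two graph isomorphisms. -/
def boxProdCongr {α β γ δ : Type*} {G : SimpleGraph α} {G' : SimpleGraph β}
    {H : SimpleGraph γ} {H' : SimpleGraph δ} (e : G ≃g G') (f : H ≃g H') :
    G.boxProd H ≃g G'.boxProd H' where
  toEquiv := e.toEquiv.prodCongr f.toEquiv
  map_rel_iff' {x y} := by
    simp [SimpleGraph.boxProd_adj, SimpleGraph.Iso.map_adj_iff]

/-- `τ` is the flip of a `K₂`-factor of `P` with coordinate function `c`. -/
structure IsPrismFlip {X : Type*} (P : SimpleGraph X) (τ : P ≃g P) (c : X → Fin 2) : Prop where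
  involutive : ∀ x, τ (τ x) = x
  adj : ∀ x, P.Adj x (τ x)
  coord_ne : ∀ x, c (τ x) ≠ c x
  coord_eq : ∀ x y, P.Adj x y → y ≠ τ x → c y = c x

namespace IsPrismFlip

variable {X : Type*} {P : SimpleGraph X} {τ σ : P ≃g P} {c d : X → Fin 2}

theorem conj (h : IsPrismFlip P τ c) (φ : P ≃g P) :
    IsPrismFlip P ((φ.symm.trans τ).trans φ) (fun x => c (φ.symm x)) where
  involutive x := by simp [h.involutive]
  adj x := by
    have := φ.map_adj_iff.2 (h.adj (φ.symm x))
    simpa using this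
  coord_ne x := by simpa using h.coord_ne (φ.symm x)
  coord_eq x y hxy hne := by
    refine h.coord_eq _ _ (φ.symm.map_adj_iff.2 hxy) fun he => hne ?_
    have := congrArg φ he
    simpa using this

theorem coord_eq_of_ne (hσ : IsPrismFlip P σ d) (hτ : IsPrismFlip P τ c) {x : X}
    (h : τ x ≠ σ x) : d (τ x) = d x :=
  hσ.coord_eq _ _ (hτ.adj x) h

theorem commute (hτ : IsPrismFlip P τ c) (hσ : IsPrismFlip P σ d) (x : X) :
    σ (τ x) = τ (σ x) := by
  by_cases h : τ x = σ x
  · rw [h, hσ.involutive, ← h, hτ.involutive]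
  · have h1 : c (σ x) = c x := hτ.coord_eq_of_ne hσ (Ne.symm h)
    have h2 : c (σ (τ x)) = c (τ x) := by
      refine hτ.coord_eq _ _ (hσ.adj _) fun he => h ?_
      rw [hτ.involutive] at he
      rw [← hσ.involutive (τ x), he]
    by_contra hne
    have h3 := hτ.coord_eq _ _ (σ.map_adj_iff.2 (hτ.adj x)) hne
    exact hτ.coord_ne x (by rw [← h2, h3, h1])

/-- The exchange of two `K₂`-factors. -/
def exchange (τ σ : P ≃g P) (c d : X → Fin 2) (x : X) : X :=
  if c x = d x then x else σ (τ x)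

theorem exchange_comp_flip (hτ : IsPrismFlip P τ c) (hσ : IsPrismFlip P σ d) (x : X) :
    exchange τ σ c d (τ x) = σ (exchange τ σ c d x) := by
  have hc := hτ.coord_ne x
  unfold exchange
  by_cases h : τ x = σ x
  · have hd := hσ.coord_ne x
    rw [← h] at hd
    have e : σ (τ x) = x := by rw [h, hσ.involutive]
    rw [hτ.involutive, e]
    split_ifs <;> simp [h]
  · have hd := hσ.coord_eq_of_ne hτ h
    rw [hτ.involutive, hd]
    split_ifs with h1 h2 h2
    · omega
    · rw [hσ.involutive]
    · rfl
    · omega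

theorem exchange_exchange (hτ : IsPrismFlip P τ c) (hσ : IsPrismFlip P σ d) (x : X) :
    exchange τ σ c d (exchange τ σ c d x) = x := by
  by_cases h1 : c x = d x
  · simp [exchange, h1]
  by_cases h : τ x = σ x
  · have e : σ (τ x) = x := by rw [h, hσ.involutive]
    simp [exchange, h1, e]
  · have hd := hσ.coord_eq_of_ne hτ h
    have hc := hτ.coord_eq_of_ne hσ (Ne.symm h)
    have hd' := hσ.coord_ne (τ x)
    have hc' := hτ.coord_ne (σ x)
    rw [← hτ.commute hσ] at hc'
    have h2 : c (σ (τ x)) ≠ d (σ (τ x)) := by omega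
    simp only [exchange, h1, h2, if_false]
    rw [hτ.commute hσ (σ (τ x)), hσ.involutive, hτ.involutive]

theorem adj_exchange (hτ : IsPrismFlip P τ c) (hσ : IsPrismFlip P σ d) {x y : X}
    (hxy : P.Adj x y) : P.Adj (exchange τ σ c d x) (exchange τ σ c d y) := by
  by_cases hcy : y = τ x
  · subst hcy
    rw [exchange_comp_flip hτ hσ]
    exact hσ.adj _
  have h1 := hτ.coord_eq _ _ hxy hcy
  by_cases hdy : y = σ x
  · subst hdy
    have h : τ (exchange τ σ c d x) = exchange τ σ c d (σ x) := by
      rw [← exchange_exchange hτ hσ (τ (exchange τ σ c d x)), exchange_comp_flip hτ hσ,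
        exchange_exchange hτ hσ]
    rw [← h]
    exact hτ.adj _
  have h2 := hσ.coord_eq _ _ hxy hdy
  unfold exchange
  rw [h1, h2]
  split_ifs
  · exact hxy
  · exact σ.map_adj_iff.2 (τ.map_adj_iff.2 hxy)

/-- The exchange of two `K₂`-factors as a graph automorphism. -/
def exchangeIso (hτ : IsPrismFlip P τ c) (hσ : IsPrismFlip P σ d) : P ≃g P where
  toFun := exchange τ σ c d
  invFun := exchange τ σ c d
  left_inv := exchange_exchange hτ hσ
  right_inv := exchange_exchange hτ hσ
  map_rel_iff' {x y} := by
    refine ⟨fun h => ?_, adj_exchange hτ hσ⟩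
    have := adj_exchange hτ hσ h
    simpa [exchange_exchange hτ hσ] using this

theorem exchangeIso_apply (hτ : IsPrismFlip P τ c) (hσ : IsPrismFlip P σ d) (x : X) :
    hτ.exchangeIso hσ x = exchange τ σ c d x := rfl

end IsPrismFlip

namespace SimpleGraph

variable {V : Type*} (G : SimpleGraph V)

/-- The automorphism of the prism over `G` that exchanges the two copies of `G`. -/
def prismFlip : G.boxProd (⊤ : SimpleGraph (Fin 2)) ≃g G.boxProd (⊤ : SimpleGraph (Fin 2)) :=
  boxProdCongr Iso.refl (Iso.completeGraph (Equiv.swap 0 1))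

theorem prismFlip_fst (x : V × Fin 2) : (G.prismFlip x).1 = x.1 := rfl

theorem prismFlip_snd (x : V × Fin 2) : (G.prismFlip x).2 = Equiv.swap 0 1 x.2 := rfl

theorem eq_or_eq_prismFlip {x y : V × Fin 2} (h : x.1 = y.1) : x = y ∨ x = G.prismFlip y := by
  obtain ⟨u, a⟩ := x
  obtain ⟨v, b⟩ := y
  obtain rfl : u = v := h
  fin_cases a <;> fin_cases b <;> simp [Prod.ext_iff, prismFlip_fst, prismFlip_snd]

theorem isPrismFlip_prismFlip : IsPrismFlip _ G.prismFlip Prod.snd where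
  involutive x := by simp [Prod.ext_iff, prismFlip_fst, prismFlip_snd]
  adj x := by
    obtain ⟨u, a⟩ := x
    fin_cases a <;> simp [boxProd_adj, prismFlip_fst, prismFlip_snd]
  coord_ne x := by
    obtain ⟨u, a⟩ := x
    fin_cases a <;> simp [prismFlip_snd]
  coord_eq x y hxy hne := by
    rw [boxProd_adj] at hxy
    rcases hxy with ⟨-, h⟩ | ⟨hs, h⟩
    · exact h.symm
    · rcases G.eq_or_eq_prismFlip h.symm with h' | h'
      · rw [h']
      · exact absurd h' hne

variable {G}

theorem fst_apply_of_commute {ψ : V × Fin 2 → V × Fin 2}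
    (hψ : ∀ x, ψ (G.prismFlip x) = G.prismFlip (ψ x)) {x y : V × Fin 2} (h : x.1 = y.1) :
    (ψ x).1 = (ψ y).1 := by
  rcases G.eq_or_eq_prismFlip h with rfl | rfl
  · rfl
  · rw [hψ, prismFlip_fst]

theorem adj_fst_of_commute
    {ψ : G.boxProd (⊤ : SimpleGraph (Fin 2)) ≃g G.boxProd (⊤ : SimpleGraph (Fin 2))}
    (hψ : ∀ x, ψ (G.prismFlip x) = G.prismFlip (ψ x)) {u v : V} (h : G.Adj u v) :
    G.Adj (ψ (u, 0)).1 (ψ (v, 0)).1 := by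
  have h1 : (G.boxProd (⊤ : SimpleGraph (Fin 2))).Adj (ψ (u, 0)) (ψ (v, 0)) :=
    ψ.map_adj_iff.2 (boxProd_adj_left.2 h)
  rw [boxProd_adj] at h1
  rcases h1 with ⟨h1, -⟩ | ⟨h1, h2⟩
  · exact h1
  · exfalso
    rcases G.eq_or_eq_prismFlip h2 with h3 | h3
    · exact h1.ne (congrArg Prod.snd h3)
    · rw [← hψ] at h3
      exact h.ne (congrArg Prod.fst (ψ.injective h3))

/-- An automorphism of the prism commuting with the flip descends to the base graph. -/
theorem exists_iso_of_commute
    (ψ : G.boxProd (⊤ : SimpleGraph (Fin 2)) ≃g G.boxProd (⊤ : SimpleGraph (Fin 2)))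
    (hψ : ∀ x, ψ (G.prismFlip x) = G.prismFlip (ψ x)) :
    ∃ θ : G ≃g G, ∀ x, θ x.1 = (ψ x).1 := by
  have hψ' : ∀ x, ψ.symm (G.prismFlip x) = G.prismFlip (ψ.symm x) := fun x => by
    apply ψ.injective
    rw [hψ, ψ.apply_symm_apply, ψ.apply_symm_apply]
  have left : ∀ v, (ψ.symm ((ψ (v, 0)).1, 0)).1 = v := fun v => by
    rw [fst_apply_of_commute (ψ := ψ.symm) (x := ((ψ (v, 0)).1, 0)) (y := ψ (v, 0)) hψ' rfl,
      ψ.symm_apply_apply]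
  have right : ∀ v, (ψ ((ψ.symm (v, 0)).1, 0)).1 = v := fun v => by
    rw [fst_apply_of_commute (ψ := ψ) (x := ((ψ.symm (v, 0)).1, 0)) (y := ψ.symm (v, 0)) hψ rfl,
      ψ.apply_symm_apply]
  refine ⟨⟨⟨fun v => (ψ (v, 0)).1, fun v => (ψ.symm (v, 0)).1, left, right⟩, ?_⟩, ?_⟩
  · intro u v
    refine ⟨fun h => ?_, adj_fst_of_commute hψ⟩
    have := adj_fst_of_commute hψ' h
    simpa only [Equiv.coe_fn_mk, left] using this
  · exact fun x => fst_apply_of_commute hψ rfl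

/-- Vertices in the same orbit of the prism lie over the same orbit of the base graph. -/
theorem exists_iso_fst_eq
    (φ : G.boxProd (⊤ : SimpleGraph (Fin 2)) ≃g G.boxProd (⊤ : SimpleGraph (Fin 2)))
    (x : V × Fin 2) : ∃ θ : G ≃g G, θ x.1 = (φ x).1 := by
  have hτ := G.isPrismFlip_prismFlip
  have hσ := hτ.conj φ
  set σ := (φ.symm.trans G.prismFlip).trans φ with hσdef
  have hφ : ∀ y, φ (G.prismFlip y) = σ (φ y) := fun y => by simp [hσdef]
  obtain ⟨θ, hθ⟩ := exists_iso_of_commute σ (hτ.commute hσ)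
  obtain ⟨η, hη⟩ := exists_iso_of_commute (φ.trans (hσ.exchangeIso hτ)) fun y => by
    rw [RelIso.trans_apply, RelIso.trans_apply, hφ, IsPrismFlip.exchangeIso_apply,
      IsPrismFlip.exchangeIso_apply, IsPrismFlip.exchange_comp_flip hσ hτ]
  have h : η x.1 = (φ x).1 ∨ η x.1 = (σ (φ x)).1 := by
    rw [hη, RelIso.trans_apply, IsPrismFlip.exchangeIso_apply]
    unfold IsPrismFlip.exchange
    split_ifs
    · exact Or.inl rfl
    · exact Or.inr (G.prismFlip_fst _)
  rcases h with h | h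
  · exact ⟨η, h⟩
  · refine ⟨η.trans θ.symm, ?_⟩
    rw [RelIso.trans_apply, h, ← hθ, RelIso.symm_apply_apply]

end SimpleGraph

theorem IsOrbitEnum.prism {V : Type*} {G : SimpleGraph V} {ℓ : ℕ} {O : Fin ℓ → Finset V}
    (hO : IsOrbitEnum G O) :
    IsOrbitEnum (G.boxProd (⊤ : SimpleGraph (Fin 2))) (fun i => O i ×ˢ univ) := by
  refine ⟨fun v => by simpa using hO.1 v.1, fun i => ?_⟩
  obtain ⟨w, hw⟩ := hO.2 i
  refine ⟨(w, 0), fun v => ?_⟩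
  simp only [mem_product, mem_univ, and_true, hw]
  constructor
  · rintro ⟨θ, hθ⟩
    exact ⟨boxProdCongr θ (SimpleGraph.Iso.completeGraph (Equiv.swap 0 v.2)),
      Prod.ext hθ (Equiv.swap_apply_left 0 v.2)⟩
  · rintro ⟨φ, rfl⟩
    exact SimpleGraph.exists_iso_fst_eq φ (w, 0)

theorem IsOrbitDivisorMatrix.prism {V : Type*} {G : SimpleGraph V} {ℓ : ℕ}
    {O : Fin ℓ → Finset V} {S : Matrix (Fin ℓ) (Fin ℓ) ℕ} (hO : IsOrbitEnum G O)
    (hS : IsOrbitDivisorMatrix G O S) :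
    IsOrbitDivisorMatrix (G.boxProd (⊤ : SimpleGraph (Fin 2))) (fun i => O i ×ˢ univ)
      (S + 1) := by
  intro i j u hu
  have hui : u.1 ∈ O i := (mem_product.1 hu).1
  have hj : u.1 ∈ O j ↔ i = j :=
    ⟨fun h => (hO.1 u.1).unique hui h, fun h => h ▸ hui⟩
  have hset : ((O j ×ˢ univ).filter fun v =>
      (G.boxProd (⊤ : SimpleGraph (Fin 2))).Adj u v) =
      ((O j).filter fun v => G.Adj u.1 v) ×ˢ {u.2} ∪
        (if i = j then {G.prismFlip u} else ∅) := by
    ext v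
    have key : v = G.prismFlip u ↔ u.2 ≠ v.2 ∧ u.1 = v.1 := by
      refine ⟨?_, fun ⟨h1, h2⟩ => ?_⟩
      · rintro rfl
        exact ⟨(G.isPrismFlip_prismFlip.coord_ne u).symm, rfl⟩
      · exact (G.eq_or_eq_prismFlip h2.symm).resolve_left fun h => h1 (h ▸ rfl)
    have hmem : v ∈ (if i = j then {G.prismFlip u} else ∅ : Finset (V × Fin 2)) ↔
        i = j ∧ u.2 ≠ v.2 ∧ u.1 = v.1 := by
      split_ifs with h <;> simp [h, key]
    rw [mem_union, hmem, ← hj]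
    simp only [mem_filter, mem_product, mem_univ, and_true, mem_singleton,
      SimpleGraph.boxProd_adj, SimpleGraph.top_adj]
    grind
  have hdisj : Disjoint (((O j).filter fun v => G.Adj u.1 v) ×ˢ {u.2})
      (if i = j then {G.prismFlip u} else ∅ : Finset (V × Fin 2)) := by
    split_ifs
    · refine disjoint_singleton_right.2 fun h => G.isPrismFlip_prismFlip.coord_ne u ?_
      exact mem_singleton.1 (mem_product.1 h).2
    · exact disjoint_empty_right _
  rw [hset, card_union_of_disjoint hdisj, card_product, card_singleton, mul_one,
    hS i j u.1 hui, Matrix.add_apply, Matrix.one_apply]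
  split_ifs <;> simp

/-- If `G` and `H` are orbitally similar connected graphs, then the prisms
`G □ K₂` and `H □ K₂` are orbitally similar connected graphs. -/
theorem prism_orbitally_similar {V W : Type*} [Fintype V] [Fintype W]
    (G : SimpleGraph V) (H : SimpleGraph W) (hG : G.Connected) (hH : H.Connected)
    (hGH : OrbitallySimilar G H) :
    OrbitallySimilar (G.boxProd (⊤ : SimpleGraph (Fin 2)))
        (H.boxProd (⊤ : SimpleGraph (Fin 2))) ∧
      (G.boxProd (⊤ : SimpleGraph (Fin 2))).Connected ∧
      (H.boxProd (⊤ : SimpleGraph (Fin 2))).Connected := by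
  obtain ⟨ℓ, O, Q, S, hO, hQ, hSO, hSQ⟩ := hGH
  have hK : (⊤ : SimpleGraph (Fin 2)).Connected := SimpleGraph.connected_top
  exact ⟨⟨ℓ, fun i => O i ×ˢ univ, fun i => Q i ×ˢ univ, S + 1, hO.prism, hQ.prism,
    hSO.prism hO, hSQ.prism hQ⟩, hG.boxProd hK, hH.boxProd hK⟩
end

section
/- Let G be a simple graph on a finite vertex type V, let O : Fin ℓ → Finset V be an orbit enumeration of G, and let S be an orbit divisor matrix of G relative to O. Then every eigenvalue of S is an eigenvalue of the adjacency matrix of G: spectrum ℂ (S.map (Nat.cast : ℕ → ℂ)) ⊆ spectrum ℂ (G.adjMatrix ℂ). In particular every eigenvalue of S is real, since the adjacency matrix is Hermitian. -/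
open Classical Finset

/-- If the columns of `A` are grouped by a surjection `f` and the sums of the entries of a row over
each group only depend on the group of the row, then every eigenvalue of the quotient matrix is an
eigenvalue of `A`. -/
theorem Matrix.spectrum_subset_of_sum_fiber_eq {K m n : Type*} [Field K]
    [Fintype m] [DecidableEq m] [Fintype n] [DecidableEq n]
    {A : Matrix m m K} {B : Matrix n n K} {f : m → n} (hf : Function.Surjective f)
    (h : ∀ u j, ∑ v with f v = j, A u v = B (f u) j) :
    spectrum K B ⊆ spectrum K A := by
  intro μ hμ
  rw [← Matrix.spectrum_toLin', ← Module.End.hasEigenvalue_iff_mem_spectrum] at hμ ⊢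
  obtain ⟨c, hc⟩ := hμ.exists_hasEigenvector
  have hBc : B.mulVec c = μ • c := by simpa using hc.apply_eq_smul
  refine Module.End.hasEigenvalue_of_hasEigenvector (x := c ∘ f)
    ⟨Module.End.mem_eigenspace_iff.2 ?_, fun h0 => hc.2 ?_⟩
  · ext u
    have hu : ∑ j, B (f u) j * c j = μ * c (f u) := congrFun hBc (f u)
    calc ∑ v, A u v * c (f v)
        = ∑ j, ∑ v with f v = j, A u v * c (f v) := (Finset.sum_fiberwise _ _ _).symm
      _ = ∑ j, B (f u) j * c j := by
          refine Finset.sum_congr rfl fun j _ => ?_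
          rw [← h u j, Finset.sum_mul]
          refine Finset.sum_congr rfl fun v hv => ?_
          rw [(Finset.mem_filter.1 hv).2]
      _ = μ * c (f u) := hu
  · ext j
    obtain ⟨v, rfl⟩ := hf j
    exact congrFun h0 v

/-- Every eigenvalue of an orbit divisor matrix of `G` is an eigenvalue of the
adjacency matrix of `G`. -/
theorem divisor_spectrum_subset_adj_spectrum {V : Type*} [Fintype V] [DecidableEq V]
    (G : SimpleGraph V) [DecidableRel G.Adj]
    {ℓ : ℕ} (O : Fin ℓ → Finset V) (S : Matrix (Fin ℓ) (Fin ℓ) ℕ)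
    (hO : IsOrbitEnum G O) (hS : IsOrbitDivisorMatrix G O S) :
    spectrum ℂ (S.map (Nat.cast : ℕ → ℂ)) ⊆ spectrum ℂ (G.adjMatrix ℂ) := by
  choose f hf hf_unique using hO.1
  have hmem (v : V) (j : Fin ℓ) : v ∈ O j ↔ f v = j :=
    ⟨fun hv => (hf_unique v j hv).symm, fun hv => hv ▸ hf v⟩
  have hf_surj : Function.Surjective f := fun i => by
    obtain ⟨w, hw⟩ := hO.2 i
    exact ⟨w, (hmem w i).1 ((hw w).2 ⟨SimpleGraph.Iso.refl, rfl⟩)⟩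
  convert Matrix.spectrum_subset_of_sum_fiber_eq (A := G.adjMatrix ℂ) hf_surj fun u j => ?_
  have hfilter : ((univ.filter fun v => f v = j).filter fun v => G.Adj u v) =
      (O j).filter fun v => G.Adj u v := by
    ext v
    simp [hmem]
  simp only [SimpleGraph.adjMatrix_apply, Finset.sum_boole, Matrix.map_apply]
  rw [hfilter, ← hS (f u) j u (hf u)]
  congr!
end

section
/- Let G and H be orbitally similar connected simple graphs on finite nonempty vertex types V and W respectively. Then G and H have the same spectral radius: the largest eigenvalue of the real symmetric adjacency matrix A_G (the maximum over i of (Matrix.IsHermitian.eigenvalues) of A_G) equals the largest eigenvalue of A_H. -/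
open Classical Finset

open Matrix in
/-- A scalar admitting an eigenvector of a Hermitian real matrix is at most its largest
eigenvalue. -/
theorem Matrix.IsHermitian.le_sup'_eigenvalues {n : Type*} [Fintype n] [DecidableEq n] [Nonempty n]
    {A : Matrix n n ℝ} (hA : A.IsHermitian) {μ : ℝ} {v : n → ℝ} (hv : v ≠ 0)
    (h : A *ᵥ v = μ • v) :
    μ ≤ univ.sup' univ_nonempty fun i => hA.eigenvalues i := by
  have hμ : μ ∈ spectrum ℝ A := by
    rw [← spectrum_toLin']
    exact (Module.End.hasEigenvalue_of_hasEigenvector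
      ⟨Module.End.mem_eigenspace_iff.2 (by simpa using h), hv⟩).mem_spectrum
  rw [hA.spectrum_real_eq_range_eigenvalues] at hμ
  obtain ⟨i, rfl⟩ := hμ
  exact le_sup' (fun i => hA.eigenvalues i) (mem_univ i)

open Matrix in
/-- If `μ` bounds all eigenvalues of a Hermitian real matrix `A`, then `μ • 1 - A` is positive
semidefinite. -/
theorem Matrix.IsHermitian.posSemidef_smul_one_sub {n : Type*} [Fintype n] [DecidableEq n]
    {A : Matrix n n ℝ} (hA : A.IsHermitian) {μ : ℝ} (hμ : ∀ i, hA.eigenvalues i ≤ μ) :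
    (μ • (1 : Matrix n n ℝ) - A).PosSemidef := by
  have hB : (μ • (1 : Matrix n n ℝ) - A).IsHermitian :=
    (isHermitian_one.smul (IsSelfAdjoint.all μ)).sub hA
  refine hB.posSemidef_iff_eigenvalues_nonneg.2 fun i => ?_
  have hspec : hB.eigenvalues i ∈ spectrum ℝ (algebraMap ℝ (Matrix n n ℝ) μ - A) := by
    simpa only [Algebra.algebraMap_eq_smul_one] using hB.eigenvalues_mem_spectrum_real i
  rw [← spectrum.singleton_sub_eq, hA.spectrum_real_eq_range_eigenvalues] at hspec
  obtain ⟨_, rfl, _, ⟨j, rfl⟩, hj⟩ := hspec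
  rw [← hj]
  exact sub_nonneg.2 (hμ j)

open Matrix in
/-- The largest eigenvalue of an entrywise nonnegative Hermitian real matrix has an entrywise
nonnegative eigenvector. -/
theorem Matrix.IsHermitian.exists_nonneg_eigenvector {n : Type*} [Fintype n] [DecidableEq n]
    [Nonempty n] {A : Matrix n n ℝ} (hA : A.IsHermitian) (hnn : ∀ i j, 0 ≤ A i j) :
    ∃ x : n → ℝ, x ≠ 0 ∧ (∀ i, 0 ≤ x i) ∧
      A *ᵥ x = (univ.sup' univ_nonempty fun i => hA.eigenvalues i) • x := by
  set μ := univ.sup' univ_nonempty fun i => hA.eigenvalues i with hμ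
  obtain ⟨k, -, hk⟩ := exists_mem_eq_sup' univ_nonempty fun i => hA.eigenvalues i
  have hpsd := hA.posSemidef_smul_one_sub (μ := μ)
    fun i => le_sup' (fun i => hA.eigenvalues i) (mem_univ i)
  set v : n → ℝ := ⇑(hA.eigenvectorBasis k) with hv
  have hv0 : v ≠ 0 := fun h =>
    hA.eigenvectorBasis.orthonormal.ne_zero k (by ext i; exact congrFun h i)
  have hAv : A *ᵥ v = μ • v := by rw [hμ, hk]; exact hA.mulVec_eigenvectorBasis k
  have hle : v ⬝ᵥ A *ᵥ v ≤ |v| ⬝ᵥ A *ᵥ |v| := by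
    simp only [dotProduct, mulVec, Finset.mul_sum]
    refine sum_le_sum fun i _ => sum_le_sum fun j _ => ?_
    calc v i * (A i j * v j) ≤ |v i * (A i j * v j)| := le_abs_self _
      _ = |v| i * (A i j * |v| j) := by simp [abs_mul, abs_of_nonneg (hnn i j)]
  have hsq : |v| ⬝ᵥ |v| = v ⬝ᵥ v := by simp [dotProduct]
  refine ⟨|v|, by simpa using hv0, fun i => abs_nonneg (v i), ?_⟩
  have hzero : star |v| ⬝ᵥ (μ • (1 : Matrix n n ℝ) - A) *ᵥ |v| = 0 := by
    refine le_antisymm ?_ (hpsd.dotProduct_mulVec_nonneg _)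
    rw [hAv, dotProduct_smul] at hle
    simpa [sub_mulVec, smul_mulVec, hsq] using hle
  have := (hpsd.dotProduct_mulVec_zero_iff _).1 hzero
  rw [sub_mulVec, smul_mulVec, one_mulVec, sub_eq_zero] at this
  exact this.symm

open Matrix in
/-- A square matrix has a right eigenvector for `μ` if it has a left eigenvector for `μ`. -/
theorem Matrix.exists_mulVec_eq_smul_of_vecMul_eq_smul {n : Type*} [Fintype n] [DecidableEq n]
    {S : Matrix n n ℝ} {μ : ℝ} {z : n → ℝ} (hz : z ≠ 0) (h : z ᵥ* S = μ • z) :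
    ∃ y : n → ℝ, y ≠ 0 ∧ S *ᵥ y = μ • y := by
  have hdet : (S - μ • (1 : Matrix n n ℝ)).det = 0 :=
    exists_vecMul_eq_zero_iff.1 ⟨z, hz, by rw [vecMul_sub, h, vecMul_smul, vecMul_one, sub_self]⟩
  obtain ⟨y, hy, hy'⟩ := exists_mulVec_eq_zero_iff.2 hdet
  rw [sub_mulVec, smul_mulVec, one_mulVec, sub_eq_zero] at hy'
  exact ⟨y, hy, hy'⟩

/-- The vertex-by-orbit incidence matrix of an orbit enumeration. -/
noncomputable def orbitMatrix {V : Type*} {ℓ : ℕ} (O : Fin ℓ → Finset V) :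
    Matrix V (Fin ℓ) ℝ :=
  Matrix.of fun v i => if v ∈ O i then 1 else 0

section OrbitMatrix

variable {V : Type*} {G : SimpleGraph V} {ℓ : ℕ} {O : Fin ℓ → Finset V}
  {S : Matrix (Fin ℓ) (Fin ℓ) ℕ}

open Matrix

theorem IsOrbitEnum.orbitMatrix_mulVec_apply (hO : IsOrbitEnum G O) {v : V} {i : Fin ℓ}
    (hv : v ∈ O i) (y : Fin ℓ → ℝ) : (orbitMatrix O *ᵥ y) v = y i := by
  rw [mulVec, dotProduct, sum_eq_single i]
  · simp [orbitMatrix, hv]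
  · intro k _ hk
    have : v ∉ O k := fun h => hk ((hO.1 v).unique h hv)
    simp [orbitMatrix, this]
  · simp

theorem IsOrbitDivisorMatrix.adjMatrix_mul_orbitMatrix [Fintype V] [DecidableRel G.Adj]
    (hO : IsOrbitEnum G O) (hS : IsOrbitDivisorMatrix G O S) :
    G.adjMatrix ℝ * orbitMatrix O = orbitMatrix O * S.map (Nat.cast : ℕ → ℝ) := by
  ext u j
  obtain ⟨i, hi, -⟩ := hO.1 u
  change _ = (orbitMatrix O *ᵥ fun k => (S k j : ℝ)) u
  rw [hO.orbitMatrix_mulVec_apply hi, ← hS i j u hi, mul_apply]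
  simp [orbitMatrix, SimpleGraph.adjMatrix_apply, ← ite_and, Finset.filter_and]
  congr 1
  ext v
  simp

theorem IsOrbitEnum.orbitMatrix_mulVec_ne_zero (hO : IsOrbitEnum G O) {y : Fin ℓ → ℝ}
    (hy : y ≠ 0) : orbitMatrix O *ᵥ y ≠ 0 := by
  obtain ⟨i, hi⟩ := Function.ne_iff.1 hy
  obtain ⟨w, hw⟩ := hO.2 i
  have hwi : w ∈ O i := (hw w).2 ⟨SimpleGraph.Iso.refl, rfl⟩
  refine fun h => hi ?_
  rw [← hO.orbitMatrix_mulVec_apply hwi y, h]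
  rfl

theorem IsOrbitEnum.vecMul_orbitMatrix_ne_zero [Fintype V] (hO : IsOrbitEnum G O) {x : V → ℝ}
    (hx : x ≠ 0) (hnn : ∀ v, 0 ≤ x v) : x ᵥ* orbitMatrix O ≠ 0 := by
  obtain ⟨v, hv⟩ := Function.ne_iff.1 hx
  obtain ⟨i, hi, -⟩ := hO.1 v
  refine fun h => hv ?_
  have hsum : ∑ u, x u * orbitMatrix O u i = 0 := congrFun h i
  have hterm := (sum_eq_zero_iff_of_nonneg fun u _ =>
    mul_nonneg (hnn u) (by simp only [orbitMatrix, of_apply]; positivity)).1 hsum v (mem_univ v)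
  simpa [orbitMatrix, hi] using hterm

end OrbitMatrix

theorem OrbitallySimilar.symm {V W : Type*} {G : SimpleGraph V} {H : SimpleGraph W}
    (h : OrbitallySimilar G H) : OrbitallySimilar H G := by
  obtain ⟨ℓ, O, Q, S, hO, hQ, hSO, hSQ⟩ := h
  exact ⟨ℓ, Q, O, S, hQ, hO, hSQ, hSO⟩

open Matrix in
theorem OrbitallySimilar.spectral_radius_le {V W : Type*}
    [Fintype V] [Fintype W] [DecidableEq V] [DecidableEq W] [Nonempty V] [Nonempty W]
    {G : SimpleGraph V} {H : SimpleGraph W} [DecidableRel G.Adj] [DecidableRel H.Adj]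
    (hGH : OrbitallySimilar G H)
    (hA : (G.adjMatrix ℝ).IsHermitian) (hB : (H.adjMatrix ℝ).IsHermitian) :
    (univ.sup' univ_nonempty fun v => hA.eigenvalues v) ≤
      univ.sup' univ_nonempty fun w => hB.eigenvalues w := by
  obtain ⟨ℓ, O, Q, S, hO, hQ, hSO, hSQ⟩ := hGH
  obtain ⟨x, hx, hnn, hAx⟩ := hA.exists_nonneg_eigenvector fun i j => by
    rw [SimpleGraph.adjMatrix_apply]; positivity
  have hxA : x ᵥ* G.adjMatrix ℝ = (univ.sup' univ_nonempty fun v => hA.eigenvalues v) • x := by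
    rw [← mulVec_transpose, SimpleGraph.transpose_adjMatrix, hAx]
  obtain ⟨y, hy, hSy⟩ := exists_mulVec_eq_smul_of_vecMul_eq_smul
    (hO.vecMul_orbitMatrix_ne_zero hx hnn) (S := S.map Nat.cast) (by
      rw [vecMul_vecMul, ← hSO.adjMatrix_mul_orbitMatrix hO, ← vecMul_vecMul, hxA, smul_vecMul])
  refine hB.le_sup'_eigenvalues (hQ.orbitMatrix_mulVec_ne_zero hy) ?_
  rw [mulVec_mulVec, hSQ.adjMatrix_mul_orbitMatrix hQ, ← mulVec_mulVec, hSy, mulVec_smul]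

/-- Orbitally similar connected graphs have the same spectral radius, i.e. the
same largest adjacency eigenvalue. -/
theorem spectral_radius_eq_of_orbitally_similar {V W : Type*}
    [Fintype V] [Fintype W] [DecidableEq V] [DecidableEq W] [Nonempty V] [Nonempty W]
    (G : SimpleGraph V) (H : SimpleGraph W) [DecidableRel G.Adj] [DecidableRel H.Adj]
    (hG : G.Connected) (hH : H.Connected) (hGH : OrbitallySimilar G H)
    (hA : (G.adjMatrix ℝ).IsHermitian) (hB : (H.adjMatrix ℝ).IsHermitian) :
    (Finset.univ.sup' Finset.univ_nonempty fun v => hA.eigenvalues v) =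
      Finset.univ.sup' Finset.univ_nonempty fun w => hB.eigenvalues w :=
  le_antisymm (hGH.spectral_radius_le hA hB) (hGH.symm.spectral_radius_le hB hA)
end

section
/- Let G and H be orbitally similar connected simple graphs on finite nonempty vertex types V and W respectively. Then G and H have the same minimum degree and the same maximum degree: min over v ∈ V of G.degree v equals min over w ∈ W of H.degree w, and max over v ∈ V of G.degree v equals max over w ∈ W of H.degree w. -/
open Classical Finset

/-- The degree of a vertex of the `i`-th orbit is the `i`-th row sum of the orbit divisor
matrix. -/
theorem IsOrbitDivisorMatrix.degree_eq {V : Type*} [Fintype V] {G : SimpleGraph V}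
    [DecidableRel G.Adj] {ℓ : ℕ} {O : Fin ℓ → Finset V} {S : Matrix (Fin ℓ) (Fin ℓ) ℕ}
    (hO : IsOrbitEnum G O) (hS : IsOrbitDivisorMatrix G O S) {i : Fin ℓ} {u : V} (hu : u ∈ O i) :
    G.degree u = ∑ j, S i j := by
  choose f hf hf_unique using hO.1
  rw [← G.card_neighborFinset_eq_degree,
    Finset.card_eq_sum_card_fiberwise (f := f) (t := Finset.univ) fun _ _ => by simp]
  refine Finset.sum_congr rfl fun j _ => ?_
  rw [← hS i j u hu]
  congr 1
  ext v
  have hv : f v = j ↔ v ∈ O j := ⟨fun h => h ▸ hf v, fun h => (hf_unique v j h).symm⟩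
  simp [hv, and_comm]

theorem OrbitallySimilar.exists_degree_eq {V W : Type*} [Fintype V] [Fintype W]
    {G : SimpleGraph V} {H : SimpleGraph W} [DecidableRel G.Adj] [DecidableRel H.Adj]
    (h : OrbitallySimilar G H) (v : V) : ∃ w, H.degree w = G.degree v := by
  obtain ⟨ℓ, O, Q, S, hO, hQ, hSO, hSQ⟩ := h
  obtain ⟨i, hi, -⟩ := hO.1 v
  obtain ⟨w, hw⟩ := hQ.nonempty i
  exact ⟨w, by rw [hSO.degree_eq hO hi, hSQ.degree_eq hQ hw]⟩

/-- Orbitally similar connected graphs have the same minimum degree and the same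
maximum degree. -/
theorem min_max_degree_eq_of_orbitally_similar {V W : Type*}
    [Fintype V] [Fintype W] [Nonempty V] [Nonempty W]
    (G : SimpleGraph V) (H : SimpleGraph W) [DecidableRel G.Adj] [DecidableRel H.Adj]
    (hG : G.Connected) (hH : H.Connected) (hGH : OrbitallySimilar G H) :
    (Finset.univ.inf' Finset.univ_nonempty fun v => G.degree v) =
        (Finset.univ.inf' Finset.univ_nonempty fun w => H.degree w) ∧
      (Finset.univ.sup' Finset.univ_nonempty fun v => G.degree v) =
        (Finset.univ.sup' Finset.univ_nonempty fun w => H.degree w) := by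
  refine ⟨le_antisymm ?_ ?_, le_antisymm ?_ ?_⟩
  · refine Finset.le_inf' _ _ fun w _ => ?_
    obtain ⟨v, hv⟩ := hGH.symm.exists_degree_eq w
    exact hv ▸ Finset.inf'_le (fun v => G.degree v) (Finset.mem_univ v)
  · refine Finset.le_inf' _ _ fun v _ => ?_
    obtain ⟨w, hw⟩ := hGH.exists_degree_eq v
    exact hw ▸ Finset.inf'_le (fun w => H.degree w) (Finset.mem_univ w)
  · refine Finset.sup'_le _ _ fun v _ => ?_
    obtain ⟨w, hw⟩ := hGH.exists_degree_eq v
    exact hw ▸ Finset.le_sup' (fun w => H.degree w) (Finset.mem_univ w)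
  · refine Finset.sup'_le _ _ fun w _ => ?_
    obtain ⟨v, hv⟩ := hGH.symm.exists_degree_eq w
    exact hv ▸ Finset.le_sup' (fun v => G.degree v) (Finset.mem_univ v)
end

section
/- Let G and H be orbitally similar connected simple graphs on finite nonempty vertex types V and W respectively. Let x : V → ℝ be a Perron vector of G (x v > 0 for all v, ∑ x v = 1, A_G.mulVec x = λ • x for some λ ∈ ℝ) and y : W → ℝ a Perron vector of H. Then G and H have the same principal ratio: (max over v ∈ V of x v) / (min over v ∈ V of x v) = (max over w ∈ W of y w) / (min over w ∈ W of y w). -/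
open Classical Finset

/-- A nonnegative eigenvector of a connected graph that vanishes at one vertex is zero. -/
theorem SimpleGraph.Connected.eq_zero_of_nonneg_of_mulVec_eq_smul {V : Type*} [Fintype V]
    {G : SimpleGraph V} [DecidableRel G.Adj] (hG : G.Connected) {z : V → ℝ} {μ : ℝ}
    (hz : ∀ v, 0 ≤ z v) (h : (G.adjMatrix ℝ).mulVec z = μ • z) {v₀ : V} (h₀ : z v₀ = 0)
    (v : V) : z v = 0 := by
  have step : ∀ a b, G.Adj a b → z a = 0 → z b = 0 := by
    intro a b hab ha
    have e := congrFun h a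
    rw [SimpleGraph.adjMatrix_mulVec_apply, Pi.smul_apply, ha, smul_zero,
      Finset.sum_eq_zero_iff_of_nonneg fun u _ => hz u] at e
    exact e b (by simpa using hab)
  obtain ⟨p⟩ := hG.preconnected v₀ v
  induction p with
  | nil => exact h₀
  | cons hab _ ih => exact ih (step _ _ hab h₀)

/-- Positive eigenvectors of a connected graph are unique up to a positive factor. -/
theorem SimpleGraph.Connected.exists_pos_mul_eq_of_mulVec_eq_smul {V : Type*} [Fintype V]
    [Nonempty V] {G : SimpleGraph V} [DecidableRel G.Adj] (hG : G.Connected)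
    {x z : V → ℝ} {μ ν : ℝ} (hx : ∀ v, 0 < x v) (hz : ∀ v, 0 < z v)
    (hxe : (G.adjMatrix ℝ).mulVec x = μ • x) (hze : (G.adjMatrix ℝ).mulVec z = ν • z) :
    ∃ c : ℝ, 0 < c ∧ ∀ v, z v = c * x v := by
  have hμν : μ = ν := by
    have hpos : 0 < x ⬝ᵥ z :=
      Finset.sum_pos (fun v _ => mul_pos (hx v) (hz v)) Finset.univ_nonempty
    have e : x ⬝ᵥ (G.adjMatrix ℝ).mulVec z = (G.adjMatrix ℝ).mulVec x ⬝ᵥ z := by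
      rw [Matrix.dotProduct_mulVec, ← Matrix.mulVec_transpose, SimpleGraph.transpose_adjMatrix]
    rw [hxe, hze, dotProduct_smul, smul_dotProduct, smul_eq_mul, smul_eq_mul] at e
    exact (mul_right_cancel₀ hpos.ne' e).symm
  subst hμν
  obtain ⟨v₀, hv₀⟩ := Finite.exists_min fun v => z v / x v
  refine ⟨z v₀ / x v₀, div_pos (hz _) (hx _), fun v => ?_⟩
  have key := hG.eq_zero_of_nonneg_of_mulVec_eq_smul (z := z - (z v₀ / x v₀) • x) (μ := μ)
    (v₀ := v₀) (fun u => ?_) ?_ ?_ v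
  · simpa [sub_eq_zero] using key
  · simpa using (le_div_iff₀ (hx u)).1 (hv₀ u)
  · rw [Matrix.mulVec_sub, Matrix.mulVec_smul, hxe, hze, smul_sub, smul_comm]
  · simp [(hx v₀).ne']

/-- A Perron vector of a connected graph is invariant under automorphisms. -/
theorem SimpleGraph.Connected.apply_iso_eq_of_mulVec_eq_smul {V : Type*} [Fintype V]
    [Nonempty V] {G : SimpleGraph V} [DecidableRel G.Adj] (hG : G.Connected)
    {x : V → ℝ} {μ : ℝ} (hx : ∀ v, 0 < x v)
    (hxe : (G.adjMatrix ℝ).mulVec x = μ • x) (φ : G ≃g G) (v : V) : x (φ v) = x v := by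
  have he : (G.adjMatrix ℝ).mulVec (fun v => x (φ v)) = μ • fun v => x (φ v) := by
    ext v
    have e := congrFun hxe (φ v)
    rw [Pi.smul_apply] at e ⊢
    rw [← e]
    refine Fintype.sum_equiv φ.toEquiv _ _ fun u => ?_
    have hadj : G.Adj (φ v) (φ u) ↔ G.Adj v u := φ.map_adj_iff
    simp [SimpleGraph.adjMatrix_apply, hadj]
  obtain ⟨c, -, hc⟩ := hG.exists_pos_mul_eq_of_mulVec_eq_smul hx (fun v => hx (φ v)) hxe he
  have hsum : ∑ v, x (φ v) = ∑ v, x v := Fintype.sum_equiv φ.toEquiv _ _ fun _ => rfl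
  have hpos : 0 < ∑ v, x v := Finset.sum_pos (fun v _ => hx v) Finset.univ_nonempty
  simp_rw [hc, ← Finset.mul_sum] at hsum
  rw [hc, (mul_eq_right₀ hpos.ne').1 hsum, one_mul]

/-- The orbit enumeration amounts to a surjective index function on the vertices. -/
theorem IsOrbitEnum.exists_index {V : Type*} {G : SimpleGraph V} {ℓ : ℕ}
    {O : Fin ℓ → Finset V} (hO : IsOrbitEnum G O) :
    ∃ i : V → Fin ℓ, Function.Surjective i ∧ ∀ v j, v ∈ O j ↔ i v = j := by
  choose i hi hu using hO.1
  have hmem : ∀ v j, v ∈ O j ↔ i v = j := fun v j =>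
    ⟨fun h => (hu v j h).symm, fun h => h ▸ hi v⟩
  refine ⟨i, fun j => ?_, hmem⟩
  obtain ⟨w, hw⟩ := hO.2 j
  exact ⟨w, (hmem w j).1 ((hw w).2 ⟨SimpleGraph.Iso.refl, rfl⟩)⟩

/-- The adjacency matrix acts on functions constant on orbits through the orbit divisor matrix. -/
theorem IsOrbitDivisorMatrix.mulVec_comp {V : Type*} [Fintype V] {G : SimpleGraph V}
    [DecidableRel G.Adj] {ℓ : ℕ} {O : Fin ℓ → Finset V} {S : Matrix (Fin ℓ) (Fin ℓ) ℕ}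
    (hS : IsOrbitDivisorMatrix G O S) {i : V → Fin ℓ} (hi : ∀ v j, v ∈ O j ↔ i v = j)
    (f : Fin ℓ → ℝ) (v : V) :
    (G.adjMatrix ℝ).mulVec (f ∘ i) v = ∑ j, (S (i v) j : ℝ) * f j := by
  rw [SimpleGraph.adjMatrix_mulVec_apply, ← Finset.sum_fiberwise _ i]
  refine Finset.sum_congr rfl fun j _ => ?_
  rw [← hS (i v) j v ((hi v _).2 rfl), ← nsmul_eq_mul, ← Finset.sum_const]
  refine Finset.sum_congr ?_ fun u hu => ?_
  · ext u
    simp [hi, and_comm]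
  · simp only [Finset.mem_filter, hi] at hu
    rw [Function.comp_apply, hu.1]

/-- Orbitally similar connected graphs have the same principal ratio: the
quotient of the largest by the smallest entry of the Perron vector. -/
theorem principal_ratio_eq_of_orbitally_similar {V W : Type*}
    [Fintype V] [Fintype W] [DecidableEq V] [DecidableEq W] [Nonempty V] [Nonempty W]
    (G : SimpleGraph V) (H : SimpleGraph W) [DecidableRel G.Adj] [DecidableRel H.Adj]
    (hG : G.Connected) (hH : H.Connected) (hGH : OrbitallySimilar G H)
    (x : V → ℝ) (lamG : ℝ) (hxpos : ∀ v : V, 0 < x v) (hxsum : ∑ v : V, x v = 1)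
    (hxeig : (G.adjMatrix ℝ).mulVec x = lamG • x)
    (y : W → ℝ) (lamH : ℝ) (hypos : ∀ w : W, 0 < y w) (hysum : ∑ w : W, y w = 1)
    (hyeig : (H.adjMatrix ℝ).mulVec y = lamH • y) :
    (Finset.univ.sup' Finset.univ_nonempty x) / (Finset.univ.inf' Finset.univ_nonempty x)
      = (Finset.univ.sup' Finset.univ_nonempty y)
        / (Finset.univ.inf' Finset.univ_nonempty y) := by
  obtain ⟨ℓ, O, Q, S, hO, hQ, hSG, hSH⟩ := hGH
  obtain ⟨i, hi, hiO⟩ := hO.exists_index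
  obtain ⟨k, hk, hkQ⟩ := hQ.exists_index
  obtain ⟨f, rfl⟩ : ∃ f : Fin ℓ → ℝ, y = f ∘ k := by
    refine ⟨fun j => y (Function.surjInv hk j), funext fun w => ?_⟩
    obtain ⟨w₀, hw₀⟩ := hQ.2 (k w)
    obtain ⟨φ, hφ⟩ := (hw₀ w).1 ((hkQ _ _).2 rfl)
    obtain ⟨ψ, hψ⟩ := (hw₀ (Function.surjInv hk (k w))).1
      ((hkQ _ _).2 (Function.surjInv_eq hk _))
    rw [Function.comp_apply, ← hψ, ← hφ,
      hH.apply_iso_eq_of_mulVec_eq_smul hypos hyeig,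
      hH.apply_iso_eq_of_mulVec_eq_smul hypos hyeig]
  have hf : ∀ j, 0 < f j := hk.forall.2 hypos
  have hfS : ∀ j, ∑ l, (S j l : ℝ) * f l = lamH * f j := hk.forall.2 fun w => by
    rw [← hSH.mulVec_comp hkQ, hyeig]
    rfl
  have he : (G.adjMatrix ℝ).mulVec (f ∘ i) = lamH • (f ∘ i) := funext fun v => by
    rw [hSG.mulVec_comp hiO, hfS]
    rfl
  obtain ⟨c, hc, hcx⟩ :=
    hG.exists_pos_mul_eq_of_mulVec_eq_smul hxpos (fun v => hf (i v)) hxeig he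
  simp only [Finset.sup'_univ_eq_ciSup, Finset.inf'_univ_eq_ciInf]
  rw [← mul_div_mul_left _ _ hc.ne', Real.mul_iSup_of_nonneg hc.le,
    Real.mul_iInf_of_nonneg hc.le]
  simp_rw [← hcx, Function.comp_apply]
  rw [hi.iSup_comp, hi.iInf_comp, hk.iSup_comp, hk.iInf_comp]
end
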